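/- There exist absolute constants δ₀ ∈ (0,1), C ≥ 1 and X₀ such that the following holds. Fix δ ∈ (0, δ₀] and L, L', D₁, D₂ ≥ 1. For i = 1, 2, let Sᵢ ⊆ ℤ ∩ [−4Dᵢ, 4Dᵢ] be a nonempty finite set which is (L, L', Dᵢ)-diophantine, and let Tᵢ ∈ ℕ. Let X ≥ X₀ and suppose that Dᵢ ≥ (L'/δ)^{CL²}, Tᵢ ≥ (L'/δ)^{CL²}, and Tᵢ·Dᵢ ≤ (δ/L')^{CL²}·X for i = 1, 2. Let H₁, H₂ be positive integers with Hᵢ ≤ (δ/L')^{CL²}·Tᵢ·Dᵢ. Let ψ : ℕ → ℂ be 1-bounded and suppose 𝔼_{n∈[X,2X), t₁,t₁'∈[T₁], t₂,t₂'∈[T₂], s₁∈S₁, s₂∈S₂} Δ_{s₁(t₁,t₁')}Δ_{s₂(t₂,t₂')}ψ(n) ≥ δ. Then there exist q₁, q₂ ∈ ℕ with qᵢ ≤ (L'/δ)^{CL²} such that 𝔼_{n∈[2X], h₁,h₁'∈[H₁], h₂,h₂'∈[H₂]} Δ_{q₁(h₁,h₁')}Δ_{q₂(h₂,h₂')}ψ(n)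 ≥ (δ/L')^{CL²}. -/

import Mathlib

noncomputable section

open Finset

/-- `e(x) = exp(2πix)`. -/
def eC (x : ℝ) : ℂ := Complex.exp (2 * Real.pi * Complex.I * x)

/-- Distance to the nearest integer. -/
def dZ (x : ℝ) : ℝ := |x - (round x : ℝ)|

/-- Uniform average of a complex-valued function over a finite set. -/
def avgC {α : Type*} (s : Finset α) (f : α → ℂ) : ℂ := (∑ x ∈ s, f x) / s.card

/-- A set `S` of integers is `(L, L', D)`-diophantine. -/
def IsDiophantine (L L' D : ℝ) (S : Finset ℤ) : Prop :=
  ∀ δ θ : ℝ, 0 < δ → δ < 1 / 2 →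
    δ ≤ ‖avgC S (fun s => eC (θ * (s : ℝ)))‖ →
    ∃ q : ℕ, 0 < q ∧ (q : ℝ) ≤ (L' / δ) ^ L ∧ dZ ((q : ℝ) * θ) ≤ (L' / δ) ^ L / D

/-- Extension by zero of `f : ℕ → ℂ` to `ℤ`. -/
def ext0 (f : ℕ → ℂ) : ℤ → ℂ := fun m => if 0 ≤ m then f m.toNat else 0

/-- Difference operator: `Δ_{(a,b)} g (x) = g (x + a) * conj (g (x + b))`. -/
def del (a b : ℤ) (g : ℤ → ℂ) : ℤ → ℂ :=
  fun x => g (x + a) * (starRingEnd ℂ) (g (x + b))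


section Averages

variable {α β : Type*}

/-- Uniform average of a real-valued function over a finite set. -/
def avgR (s : Finset α) (f : α → ℝ) : ℝ := (∑ x ∈ s, f x) / s.card

theorem avgC_re (s : Finset α) (f : α → ℂ) :
    (avgC s f).re = avgR s (fun x => (f x).re) := by
  simp [avgC, avgR, Complex.div_natCast_re]

theorem avgC_comm (s : Finset α) (t : Finset β) (f : α → β → ℂ) :
    avgC s (fun x => avgC t (fun y => f x y)) = avgC t (fun y => avgC s (fun x => f x y)) := by
  simp only [avgC, ← Finset.sum_div]
  rw [Finset.sum_comm, div_right_comm]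

theorem avgR_comm (s : Finset α) (t : Finset β) (f : α → β → ℝ) :
    avgR s (fun x => avgR t (fun y => f x y)) = avgR t (fun y => avgR s (fun x => f x y)) := by
  simp only [avgR, ← Finset.sum_div]
  rw [Finset.sum_comm, div_right_comm]

theorem avgR_sum_comm (s : Finset α) (t : Finset β) (f : α → β → ℝ) :
    avgR s (fun x => ∑ y ∈ t, f x y) = ∑ y ∈ t, avgR s (fun x => f x y) := by
  simp only [avgR, ← Finset.sum_div]
  rw [Finset.sum_comm]

theorem avgR_add (s : Finset α) (f g : α → ℝ) :
    avgR s (fun x => f x + g x) = avgR s f + avgR s g := by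
  simp only [avgR, Finset.sum_add_distrib, add_div]

theorem avgR_const_mul (s : Finset α) (c : ℝ) (f : α → ℝ) :
    avgR s (fun x => c * f x) = c * avgR s f := by
  simp only [avgR, ← Finset.mul_sum, mul_div_assoc]

theorem avgR_mono {s : Finset α} {f g : α → ℝ} (h : ∀ x ∈ s, f x ≤ g x) :
    avgR s f ≤ avgR s g :=
  div_le_div_of_nonneg_right (Finset.sum_le_sum h) (Nat.cast_nonneg _)

theorem avgR_nonneg {s : Finset α} {f : α → ℝ} (h : ∀ x ∈ s, 0 ≤ f x) : 0 ≤ avgR s f :=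
  div_nonneg (Finset.sum_nonneg h) (Nat.cast_nonneg _)

theorem avgR_le_of_le {s : Finset α} {f : α → ℝ} {c : ℝ} (hc : 0 ≤ c)
    (h : ∀ x ∈ s, f x ≤ c) : avgR s f ≤ c := by
  refine div_le_of_le_mul₀ (Nat.cast_nonneg _) hc ?_
  have := Finset.sum_le_card_nsmul s f c h
  rw [nsmul_eq_mul] at this
  linarith

theorem exists_le_of_le_avgR {s : Finset α} {f : α → ℝ} {c : ℝ} (hs : s.Nonempty)
    (h : c ≤ avgR s f) : ∃ x ∈ s, c ≤ f x := by
  refine Finset.exists_le_of_sum_le (f := fun _ => c) hs ?_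
  have hpos : (0 : ℝ) < s.card := by exact_mod_cast hs.card_pos
  rw [avgR, le_div_iff₀ hpos] at h
  simpa [mul_comm] using h

theorem norm_avgC_le (s : Finset α) (f : α → ℂ) : ‖avgC s f‖ ≤ avgR s (fun x => ‖f x‖) := by
  rw [avgC, avgR, norm_div, Complex.norm_natCast]
  exact div_le_div_of_nonneg_right (norm_sum_le _ _) (Nat.cast_nonneg _)

theorem avgC_congr {s : Finset α} {f g : α → ℂ} (h : ∀ x ∈ s, f x = g x) :
    avgC s f = avgC s g := by
  rw [avgC, avgC, Finset.sum_congr rfl h]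

theorem mul_avgC (s : Finset α) (c : ℂ) (f : α → ℂ) :
    avgC s (fun x => c * f x) = c * avgC s f := by
  simp only [avgC, ← Finset.mul_sum, mul_div_assoc]

theorem conj_avgC (s : Finset α) (f : α → ℂ) :
    (starRingEnd ℂ) (avgC s f) = avgC s (fun x => (starRingEnd ℂ) (f x)) := by
  simp [avgC, map_sum]

theorem avgC_mul_conj (s : Finset α) (u : α → ℂ) :
    avgC s (fun x => avgC s (fun y => u x * (starRingEnd ℂ) (u y))) =
      (Complex.normSq (avgC s u) : ℂ) := by
  simp only [mul_avgC, ← conj_avgC]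
  rw [Complex.normSq_eq_conj_mul_self, ← mul_avgC]
  exact avgC_congr fun x _ => mul_comm _ _

end Averages

section Box

/-- The box average of the function `(t₁, t₂) ↦ g (n + a₁ t₁ + a₂ t₂)` on `I₁ × I₂`. -/
def boxAvg (I₁ I₂ : Finset ℕ) (a₁ a₂ : ℕ → ℤ) (g : ℤ → ℂ) (n : ℤ) : ℝ :=
  (avgC I₁ (fun t₁ => avgC I₁ (fun t₁' => avgC I₂ (fun t₂ => avgC I₂ (fun t₂' =>
    del (a₁ t₁) (a₁ t₁') (del (a₂ t₂) (a₂ t₂') g) n))))).re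

theorem del_comm (a a' b b' : ℤ) (g : ℤ → ℂ) :
    del a a' (del b b' g) = del b b' (del a a' g) := by
  funext x
  simp only [del, map_mul, Complex.conj_conj, add_right_comm x a b, add_right_comm x a' b,
    add_right_comm x a b', add_right_comm x a' b']
  ring

theorem boxAvg_comm (I₁ I₂ : Finset ℕ) (a₁ a₂ : ℕ → ℤ) (g : ℤ → ℂ) (n : ℤ) :
    boxAvg I₁ I₂ a₁ a₂ g n = boxAvg I₂ I₁ a₂ a₁ g n := by
  simp only [boxAvg]
  congr 1
  calc _ = avgC I₁ (fun t₁ => avgC I₂ (fun t₂ => avgC I₁ (fun t₁' => avgC I₂ (fun t₂' =>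
      del (a₁ t₁) (a₁ t₁') (del (a₂ t₂) (a₂ t₂') g) n)))) :=
        avgC_congr fun _ _ => avgC_comm _ _ _
    _ = avgC I₂ (fun t₂ => avgC I₁ (fun t₁ => avgC I₁ (fun t₁' => avgC I₂ (fun t₂' =>
      del (a₁ t₁) (a₁ t₁') (del (a₂ t₂) (a₂ t₂') g) n)))) := avgC_comm _ _ _
    _ = avgC I₂ (fun t₂ => avgC I₁ (fun t₁ => avgC I₂ (fun t₂' => avgC I₁ (fun t₁' =>
      del (a₁ t₁) (a₁ t₁') (del (a₂ t₂) (a₂ t₂') g) n)))) :=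
        avgC_congr fun _ _ => avgC_congr fun _ _ => avgC_comm _ _ _
    _ = avgC I₂ (fun t₂ => avgC I₂ (fun t₂' => avgC I₁ (fun t₁ => avgC I₁ (fun t₁' =>
      del (a₁ t₁) (a₁ t₁') (del (a₂ t₂) (a₂ t₂') g) n)))) :=
        avgC_congr fun _ _ => avgC_comm _ _ _
    _ = _ := by simp only [del_comm (a₁ _)]

theorem boxAvg_eq_avgR_normSq (I₁ I₂ : Finset ℕ) (a₁ a₂ : ℕ → ℤ) (g : ℤ → ℂ) (n : ℤ) :
    boxAvg I₁ I₂ a₁ a₂ g n = avgR I₂ (fun t₂ => avgR I₂ (fun t₂' =>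
      Complex.normSq (avgC I₁ (fun t₁ => del (a₂ t₂) (a₂ t₂') g (n + a₁ t₁))))) := by
  rw [boxAvg_comm, boxAvg]
  simp only [avgC_re]
  congr 1; funext t₂; congr 1; funext t₂'
  simp only [← avgC_re]
  rw [← Complex.ofReal_re (Complex.normSq _), ← avgC_mul_conj]
  simp only [del_comm (a₂ _)]
  rfl

theorem boxAvg_nonneg (I₁ I₂ : Finset ℕ) (a₁ a₂ : ℕ → ℤ) (g : ℤ → ℂ) (n : ℤ) :
    0 ≤ boxAvg I₁ I₂ a₁ a₂ g n := by
  rw [boxAvg_eq_avgR_normSq]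
  exact avgR_nonneg fun _ _ => avgR_nonneg fun _ _ => Complex.normSq_nonneg _

theorem norm_del_le_one {g : ℤ → ℂ} (hg : ∀ x, ‖g x‖ ≤ 1) (a b x : ℤ) : ‖del a b g x‖ ≤ 1 := by
  rw [del, norm_mul, Complex.norm_conj]
  exact mul_le_one₀ (hg _) (norm_nonneg _) (hg _)

theorem normSq_avgC_le_one {α : Type*} {s : Finset α} {f : α → ℂ} (h : ∀ x ∈ s, ‖f x‖ ≤ 1) :
    Complex.normSq (avgC s f) ≤ 1 := by
  rw [Complex.normSq_eq_norm_sq]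
  exact pow_le_one₀ (norm_nonneg _) ((norm_avgC_le _ _).trans (avgR_le_of_le zero_le_one h))

theorem boxAvg_le_one {g : ℤ → ℂ} (hg : ∀ x, ‖g x‖ ≤ 1) (I₁ I₂ : Finset ℕ) (a₁ a₂ : ℕ → ℤ)
    (n : ℤ) : boxAvg I₁ I₂ a₁ a₂ g n ≤ 1 := by
  rw [boxAvg_eq_avgR_normSq]
  exact avgR_le_of_le zero_le_one fun _ _ => avgR_le_of_le zero_le_one fun _ _ =>
    normSq_avgC_le_one fun _ _ => norm_del_le_one hg _ _ _

theorem boxAvg_congr {g g' : ℤ → ℂ} {I₁ I₂ : Finset ℕ} {a₁ a₂ : ℕ → ℤ} {n : ℤ}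
    (h : ∀ t₁ ∈ I₁, ∀ t₂ ∈ I₂, g (n + a₁ t₁ + a₂ t₂) = g' (n + a₁ t₁ + a₂ t₂)) :
    boxAvg I₁ I₂ a₁ a₂ g n = boxAvg I₁ I₂ a₁ a₂ g' n := by
  refine congrArg Complex.re <| avgC_congr fun t₁ h₁ => avgC_congr fun t₁' h₁' =>
    avgC_congr fun t₂ h₂ => avgC_congr fun t₂' h₂' => ?_
  simp only [del, h _ h₁ _ h₂, h _ h₁' _ h₂, h _ h₁ _ h₂', h _ h₁' _ h₂']

end Box

section DistInt

theorem eC_add (x y : ℝ) : eC (x + y) = eC x * eC y := by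
  simp only [eC, ← Complex.exp_add]
  congr 1
  push_cast
  ring

theorem eC_zero : eC 0 = 1 := by simp [eC]

theorem eC_intCast (n : ℤ) : eC n = 1 := by
  rw [eC, ← Complex.exp_int_mul_two_pi_mul_I n]
  congr 1
  push_cast
  ring

theorem conj_eC (x : ℝ) : (starRingEnd ℂ) (eC x) = eC (-x) := by
  rw [eC, eC, ← Complex.exp_conj]
  congr 1
  simp only [map_mul, map_ofNat, Complex.conj_ofReal, Complex.conj_I, Complex.ofReal_neg]
  ring

theorem eC_re (x : ℝ) : (eC x).re = Real.cos (2 * Real.pi * x) := by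
  rw [eC, ← Complex.exp_ofReal_mul_I_re]
  congr 2
  push_cast
  ring

theorem norm_eC (x : ℝ) : ‖eC x‖ = 1 := by
  rw [eC, ← Complex.norm_exp_ofReal_mul_I (2 * Real.pi * x)]
  congr 2
  push_cast
  ring

theorem continuous_eC : Continuous eC := by
  unfold eC
  fun_prop

theorem dZ_le_abs_sub (x : ℝ) (m : ℤ) : dZ x ≤ |x - m| := round_le x m

theorem dZ_sub_le (x y : ℝ) : dZ (x - y) ≤ dZ x + dZ y := by
  refine (dZ_le_abs_sub _ (round x - round y)).trans ?_
  have : x - y - ((round x - round y : ℤ) : ℝ) = (x - round x) - (y - round y) := by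
    push_cast; ring
  rw [this]
  exact abs_sub _ _

theorem dZ_eq_abs_of_abs_sub_le {x : ℝ} {m : ℤ} (h : |x - m| ≤ 1 / 2) : dZ x = |x - m| := by
  refine le_antisymm (dZ_le_abs_sub x m) ?_
  by_cases hm : round x = m
  · rw [dZ, hm]
  · have h1 : (1 : ℝ) ≤ |((round x - m : ℤ) : ℝ)| := by
      exact_mod_cast Int.one_le_abs (sub_ne_zero.mpr hm)
    have h2 : |((round x - m : ℤ) : ℝ)| ≤ |x - m| + dZ x := by
      have : ((round x - m : ℤ) : ℝ) = (x - m) - (x - round x) := by push_cast; ring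
      rw [this]
      exact abs_sub _ _
    linarith

theorem dZ_nonneg (x : ℝ) : 0 ≤ dZ x := abs_nonneg _

/-- If `v`-spaced translates of a subset of `[1, T]` are too many to be disjoint,
then a multiple of `v` is a difference of two elements of the set. -/
theorem exists_sub_eq_mul_of_card_lt {G : Finset ℕ} {T I v : ℕ} (hG : G ⊆ Finset.Icc 1 T)
    (h : T + I * v < I * G.card) :
    ∃ i, 0 < i ∧ i < I ∧ ∃ t ∈ G, ∃ u ∈ G, (t : ℤ) - u = i * v := by
  have hmap : ∀ p ∈ Finset.range I ×ˢ G, p.2 + p.1 * v ∈ Finset.Icc 1 (T + I * v) := by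
    intro p hp
    obtain ⟨hp1, hp2⟩ := Finset.mem_product.mp hp
    have h1 := Finset.mem_Icc.mp (hG hp2)
    have h2 : p.1 * v ≤ I * v := Nat.mul_le_mul_right _ (Finset.mem_range.mp hp1).le
    exact Finset.mem_Icc.mpr ⟨by omega, by omega⟩
  obtain ⟨x, hx, y, hy, hne, hxy⟩ := Finset.exists_ne_map_eq_of_card_lt_of_maps_to
    (by simpa using h) hmap
  simp only [Finset.mem_product, Finset.mem_range] at hx hy
  have hxy' : (x.2 : ℤ) + x.1 * v = y.2 + y.1 * v := by exact_mod_cast hxy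
  rcases lt_trichotomy x.1 y.1 with hlt | heq | hlt
  · refine ⟨y.1 - x.1, by omega, by omega, x.2, hx.2, y.2, hy.2, ?_⟩
    push_cast [hlt.le]
    linarith
  · exact absurd (Prod.ext heq (by rw [heq] at hxy; exact Nat.add_right_cancel hxy)) hne
  · refine ⟨x.1 - y.1, by omega, by omega, y.2, hy.2, x.2, hx.2, ?_⟩
    push_cast [hlt.le]
    linarith

/-- Vinogradov's lemma: if many `t ≤ T` have `t α` in a common short arc modulo one, then `α` is
very close to a rational with small denominator. -/
theorem exists_dZ_mul_le_of_many {G : Finset ℕ} {T I : ℕ} {α ε : ℝ} (hG : G ⊆ Finset.Icc 1 T)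
    (hα : ∀ t ∈ G, ∀ u ∈ G, dZ (((t : ℝ) - u) * α) ≤ ε) (hcard : 2 * T ≤ I * G.card)
    (hIT : I < T) (hε : ε * I ≤ 1 / 4) :
    ∃ d : ℕ, 0 < d ∧ d < I ∧ dZ (d * α) ≤ 2 * ε * I ^ 2 / T := by
  obtain ⟨d, hd0, hdI, t, ht, u, hu, htu⟩ :=
    exists_sub_eq_mul_of_card_lt (v := 1) hG (show T + I * 1 < I * G.card by omega)
  refine ⟨d, hd0, hdI, ?_⟩
  have htu' : (t : ℝ) - u = d := by exact_mod_cast (by simpa using htu : (t : ℤ) - u = d)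
  have hb : dZ (d * α) ≤ ε := htu' ▸ hα t ht u hu
  set b := dZ (d * α) with hbdef
  have hb0 : 0 ≤ b := dZ_nonneg _
  have hε0 : 0 ≤ ε := hb0.trans hb
  have hT : (0 : ℝ) < T := by exact_mod_cast (Nat.zero_le I).trans_lt hIT
  rcases hb0.eq_or_lt with hb0 | hb0
  · rw [← hb0]; positivity
  set J := ⌊ε / b⌋₊ + 1 with hJ
  have hJ1 : ε < J * b := by
    rw [← div_lt_iff₀ hb0]; push_cast [hJ]; exact Nat.lt_floor_add_one _
  have hJ2 : J * b ≤ 2 * ε := by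
    have : (⌊ε / b⌋₊ : ℝ) * b ≤ ε := by
      rw [← le_div_iff₀ hb0]; exact Nat.floor_le (by positivity)
    push_cast [hJ]; linarith
  have key : T ≤ I * (J * d) := by
    by_contra! hlt
    obtain ⟨i, hi0, hiI, t, ht, u, hu, htu⟩ :=
      exists_sub_eq_mul_of_card_lt (v := J * d) hG (show T + I * (J * d) < I * G.card by omega)
    have h1 := hα t ht u hu
    have htu' : (t : ℝ) - u = i * (J * d) := by exact_mod_cast htu
    have hiI' : (i : ℝ) ≤ I := by exact_mod_cast hiI.le
    have hi1 : (1 : ℝ) ≤ i := by exact_mod_cast hi0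
    have h2 : |((t : ℝ) - u) * α - ((i * J * round (d * α) : ℤ) : ℝ)| = i * (J * b) := by
      rw [htu']
      have : (i : ℝ) * (J * d) * α - ((i * J * round (d * α) : ℤ) : ℝ) =
          (i * J) * (d * α - round (d * α)) := by push_cast; ring
      rw [this, abs_mul, abs_of_nonneg (by positivity), hbdef, dZ, mul_assoc]
    have h3 : (i : ℝ) * (J * b) ≤ 1 / 2 := by
      calc (i : ℝ) * (J * b) ≤ I * (2 * ε) := by gcongr
        _ ≤ 1 / 2 := by linarith
    rw [dZ_eq_abs_of_abs_sub_le (h2.trans_le h3), h2] at h1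
    nlinarith
  have key' : (T : ℝ) ≤ I * (J * d) := by exact_mod_cast key
  have hdI' : (d : ℝ) ≤ I := by exact_mod_cast hdI.le
  rw [le_div_iff₀ hT]
  calc b * T ≤ b * (I * (J * d)) := by gcongr
    _ = (J * b) * I * d := by ring
    _ ≤ 2 * ε * I * I := by gcongr
    _ = 2 * ε * I ^ 2 := by ring

end DistInt

section Pointwise

theorem avgR_normSq_le (S : Finset ℤ) (I : Finset ℕ) (θ : ℝ) :
    avgR S (fun s => Complex.normSq (avgC I (fun t => eC (((s * (t : ℤ) : ℤ) : ℝ) * θ)))) ≤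
      avgR I (fun t => avgR I (fun u =>
        ‖avgC S (fun s => eC ((((t : ℝ) - u) * θ) * (s : ℝ)))‖)) := by
  have h : avgR S (fun s => Complex.normSq (avgC I (fun t => eC (((s * (t : ℤ) : ℤ) : ℝ) * θ)))) =
      (avgC I (fun t => avgC I (fun u =>
        avgC S (fun s => eC ((((t : ℝ) - u) * θ) * (s : ℝ)))))).re := by
    calc _ = (avgC S (fun s => avgC I (fun t => avgC I (fun u =>
          eC ((((t : ℝ) - u) * θ) * (s : ℝ)))))).re := by
          rw [avgC_re]
          congr 1; funext s
          rw [← Complex.ofReal_re (Complex.normSq _), ← avgC_mul_conj]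
          refine congrArg Complex.re <| avgC_congr fun t _ => avgC_congr fun u _ => ?_
          rw [conj_eC, ← eC_add]
          congr 1
          push_cast
          ring
      _ = (avgC I (fun t => avgC S (fun s => avgC I (fun u =>
          eC ((((t : ℝ) - u) * θ) * (s : ℝ)))))).re := by rw [avgC_comm]
      _ = _ := congrArg Complex.re <| avgC_congr fun t _ => avgC_comm _ _ _
  rw [h]
  refine (Complex.re_le_norm _).trans ((norm_avgC_le _ _).trans (avgR_mono fun t _ => ?_))
  exact norm_avgC_le _ _

/-- If the average `𝔼_{t ∈ I} f t` of a function bounded by one is at least `η`, then `f ≥ η / 2`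
on a subset of density at least `η / 2`. -/
theorem half_mul_card_le_card_filter {I : Finset ℕ} {f : ℕ → ℝ} {η : ℝ} (hη : 0 < η)
    (hf : ∀ t ∈ I, f t ≤ 1) (h : η ≤ avgR I f) :
    η / 2 * I.card ≤ ((I.filter (fun t => η / 2 ≤ f t)).card : ℝ) := by
  rcases I.eq_empty_or_nonempty with rfl | hI
  · simp
  have hpos : (0 : ℝ) < I.card := by exact_mod_cast hI.card_pos
  rw [avgR, le_div_iff₀ hpos] at h
  have h1 : ∑ t ∈ I, f t ≤ ∑ t ∈ I, ((if η / 2 ≤ f t then 1 else 0) + η / 2) := by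
    refine Finset.sum_le_sum fun t ht => ?_
    split_ifs with h2
    · linarith [hf t ht]
    · linarith
  rw [Finset.sum_add_distrib, Finset.sum_boole, Finset.sum_const, nsmul_eq_mul] at h1
  linarith

theorem exists_dZ_mul_le_of_le_avgR {L L' D η P θ : ℝ} {S : Finset ℤ} {T : ℕ}
    (hS : IsDiophantine L L' D S) (hη : 0 < η) (hη1 : η < 1) (hP : 8 ≤ P) (hPη : 1 ≤ P * η)
    (hPL : (2 * L' / η) ^ L ≤ P) (hD : P ^ 5 ≤ D) (hT : P ^ 4 ≤ T)
    (hW : η ≤ avgR S (fun s => Complex.normSq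
      (avgC (Finset.Icc 1 T) (fun t => eC (((s * (t : ℤ) : ℤ) : ℝ) * θ))))) :
    ∃ q : ℕ, 0 < q ∧ (q : ℝ) ≤ P ^ 4 ∧ dZ (q * θ) ≤ P ^ 8 / (T * D) := by
  have hP0 : 0 < P := by linarith
  have hD0 : 0 < D := lt_of_lt_of_le (by positivity) hD
  have hT0 : (0 : ℝ) < T := lt_of_lt_of_le (by positivity) hT
  have hTne : (Finset.Icc 1 T).Nonempty := by
    rw [Finset.nonempty_Icc]; exact_mod_cast hT0
  obtain ⟨t, -, ht⟩ := exists_le_of_le_avgR hTne (hW.trans (avgR_normSq_le S _ θ))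
  have hG := half_mul_card_le_card_filter hη (fun u _ => (norm_avgC_le _ _).trans
    (avgR_le_of_le zero_le_one fun s _ => (norm_eC _).le)) ht
  set G := (Finset.Icc 1 T).filter (fun u : ℕ => η / 2 ≤
    ‖avgC S (fun s => eC ((((t : ℝ) - u) * θ) * (s : ℝ)))‖) with hGdef
  rw [Nat.card_Icc, Nat.add_sub_cancel] at hG
  have hex : ∀ u : ℕ, ∃ q : ℕ, u ∈ G →
      0 < q ∧ (q : ℝ) ≤ P ∧ dZ (q * (((t : ℝ) - u) * θ)) ≤ P / D := by
    intro u
    by_cases hu : u ∈ G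
    · obtain ⟨q, hq0, hq1, hq2⟩ := hS (η / 2) (((t : ℝ) - u) * θ) (by linarith) (by linarith)
        (Finset.mem_filter.mp hu).2
      have : L' / (η / 2) = 2 * L' / η := by field_simp
      rw [this] at hq1 hq2
      exact ⟨q, fun _ => ⟨hq0, hq1.trans hPL, hq2.trans (by gcongr)⟩⟩
    · exact ⟨0, fun h => absurd h hu⟩
  choose Q hQ using hex
  have hmap : ∀ u ∈ G, Q u ∈ Finset.Icc 1 ⌊P⌋₊ := fun u hu =>
    Finset.mem_Icc.mpr ⟨(hQ u hu).1, Nat.le_floor (hQ u hu).2.1⟩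
  have hfl : (⌊P⌋₊ : ℝ) ≤ P := Nat.floor_le hP0.le
  obtain ⟨q, hq, hcard⟩ := Finset.exists_le_card_fiber_of_nsmul_le_card_of_maps_to hmap
    (b := η * T / (2 * P))
    (by rw [Finset.nonempty_Icc]; exact Nat.le_floor (by push_cast; linarith))
    (by
      rw [nsmul_eq_mul, Nat.card_Icc, Nat.add_sub_cancel]
      calc (⌊P⌋₊ : ℝ) * (η * T / (2 * P)) ≤ P * (η * T / (2 * P)) := by gcongr
        _ = η / 2 * T := by field_simp
        _ ≤ _ := hG)
  set G' := G.filter (fun u => Q u = q) with hG'def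
  have hqP : (q : ℝ) ≤ P := (Nat.cast_le.mpr (Finset.mem_Icc.mp hq).2).trans hfl
  have hsub : G' ⊆ Finset.Icc 1 T := (Finset.filter_subset _ _).trans (Finset.filter_subset _ _)
  have hdist : ∀ u ∈ G', ∀ w ∈ G', dZ (((u : ℝ) - w) * (q * θ)) ≤ 2 * (P / D) := by
    intro u hu w hw
    obtain ⟨hu1, hu2⟩ := Finset.mem_filter.mp hu
    obtain ⟨hw1, hw2⟩ := Finset.mem_filter.mp hw
    have h1 := (hQ u hu1).2.2
    have h2 := (hQ w hw1).2.2
    rw [hu2] at h1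
    rw [hw2] at h2
    have : ((u : ℝ) - w) * (q * θ) = q * (((t : ℝ) - w) * θ) - q * (((t : ℝ) - u) * θ) := by ring
    rw [this]
    linarith [dZ_sub_le (q * (((t : ℝ) - w) * θ)) (q * (((t : ℝ) - u) * θ))]
  set I := ⌈4 * P / η⌉₊ with hI
  have hI1 : 4 * P / η ≤ I := Nat.le_ceil _
  have hI2 : (I : ℝ) ≤ P ^ 3 := by
    have h1 : (I : ℝ) < 4 * P / η + 1 := Nat.ceil_lt_add_one (by positivity)
    have h2 : 4 * P / η ≤ 4 * P * P := by rw [div_le_iff₀ hη]; nlinarith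
    nlinarith
  have hcard' : 2 * T ≤ I * G'.card := by
    have : (2 * T : ℝ) ≤ I * G'.card := by
      calc (2 * T : ℝ) = 4 * P / η * (η * T / (2 * P)) := by field_simp; ring
        _ ≤ I * G'.card := by gcongr
    exact_mod_cast this
  have hIT : I < T := by
    have : (I : ℝ) < T := by
      refine hI2.trans_lt (lt_of_lt_of_le ?_ hT)
      exact pow_lt_pow_right₀ (by linarith) (by norm_num)
    exact_mod_cast this
  have hεI : 2 * (P / D) * I ≤ 1 / 4 := by
    calc 2 * (P / D) * I ≤ 2 * (P / P ^ 5) * P ^ 3 := by gcongr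
      _ = 2 / P := by field_simp
      _ ≤ 1 / 4 := by rw [div_le_iff₀ hP0]; linarith
  obtain ⟨d, hd0, hdI, hd⟩ := exists_dZ_mul_le_of_many hsub hdist hcard' hIT hεI
  have hdP : (d : ℝ) ≤ P ^ 3 := (Nat.cast_le.mpr hdI.le).trans hI2
  refine ⟨d * q, Nat.mul_pos hd0 (Finset.mem_Icc.mp hq).1, ?_, ?_⟩
  · push_cast
    calc (d : ℝ) * q ≤ P ^ 3 * P := by gcongr
      _ = P ^ 4 := by ring
  · push_cast
    rw [mul_assoc]
    refine hd.trans ?_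
    calc 2 * (2 * (P / D)) * (I : ℝ) ^ 2 / T ≤ 2 * (2 * (P / D)) * (P ^ 3) ^ 2 / T := by gcongr
      _ = 4 * P ^ 7 / (T * D) := by field_simp; ring
      _ ≤ P ^ 8 / (T * D) := by
        gcongr
        nlinarith [pow_pos hP0 7]

/-- A progression `θ, 2θ, …, Hθ` that stays close to zero modulo one has a large exponential sum. -/
theorem one_fourth_le_normSq_avgC {H : ℕ} {q : ℤ} {θ : ℝ} (hH : 0 < H)
    (h : H * dZ (q * θ) ≤ 1 / 6) :
    1 / 4 ≤ Complex.normSq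
      (avgC (Finset.Icc 1 H) (fun h => eC (((q * (h : ℤ) : ℤ) : ℝ) * θ))) := by
  have hne : (Finset.Icc 1 H).Nonempty := by rw [Finset.nonempty_Icc]; exact hH
  have hcos : ∀ k ∈ Finset.Icc 1 H, 1 / 2 ≤ (eC (((q * (k : ℤ) : ℤ) : ℝ) * θ)).re := by
    intro k hk
    have hk' : (k : ℝ) ≤ H := by exact_mod_cast (Finset.mem_Icc.mp hk).2
    have hsplit : ((q * (k : ℤ) : ℤ) : ℝ) * θ =
        k * (q * θ - round (q * θ)) + ((k * round (q * θ) : ℤ) : ℝ) := by push_cast; ring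
    rw [hsplit, eC_add, eC_intCast, mul_one, eC_re, ← Real.cos_pi_div_three,
      ← Real.cos_abs (2 * Real.pi * _)]
    have habs : |2 * Real.pi * (k * (q * θ - round (q * θ)))| = 2 * Real.pi * (k * dZ (q * θ)) := by
      rw [abs_mul, abs_of_pos Real.two_pi_pos, abs_mul, Nat.abs_cast, dZ]
    have hle : (k : ℝ) * dZ (q * θ) ≤ 1 / 6 :=
      (mul_le_mul_of_nonneg_right hk' (dZ_nonneg _)).trans h
    refine Real.cos_le_cos_of_nonneg_of_le_pi (abs_nonneg _) (by linarith [Real.pi_pos]) ?_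
    rw [habs]
    nlinarith [Real.pi_pos]
  have hre : 1 / 2 ≤ (avgC (Finset.Icc 1 H) (fun h => eC (((q * (h : ℤ) : ℤ) : ℝ) * θ))).re := by
    rw [avgC_re, avgR, le_div_iff₀ (by exact_mod_cast hne.card_pos)]
    have := Finset.card_nsmul_le_sum _ _ _ hcos
    rw [nsmul_eq_mul] at this
    linarith
  rw [Complex.normSq_apply]
  nlinarith [mul_self_nonneg
    (avgC (Finset.Icc 1 H) (fun h => eC (((q * (h : ℤ) : ℤ) : ℝ) * θ))).im]

/-- The Fourier multiplier of a diophantine average is dominated by those of averages along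
progressions with small common difference. -/
theorem avgR_normSq_le_add_sum {L L' D η P θ : ℝ} {S : Finset ℤ} {T H : ℕ}
    (hS : IsDiophantine L L' D S) (hη : 0 < η) (hη1 : η < 1) (hP : 8 ≤ P) (hPη : 1 ≤ P * η)
    (hPL : (2 * L' / η) ^ L ≤ P) (hD : P ^ 5 ≤ D) (hT : P ^ 4 ≤ T) (hH : 0 < H)
    (hHT : H * P ^ 9 ≤ T * D) :
    avgR S (fun s => Complex.normSq
      (avgC (Finset.Icc 1 T) (fun t => eC (((s * (t : ℤ) : ℤ) : ℝ) * θ)))) ≤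
    η + 4 * ∑ q ∈ Finset.Icc 1 ⌊P ^ 4⌋₊, Complex.normSq
      (avgC (Finset.Icc 1 H) (fun h => eC ((((q : ℤ) * (h : ℤ) : ℤ) : ℝ) * θ))) := by
  have hP0 : 0 < P := by linarith
  have hD0 : 0 < D := lt_of_lt_of_le (by positivity) hD
  have hT0 : (0 : ℝ) < T := lt_of_lt_of_le (by positivity) hT
  have hnn : ∀ q ∈ Finset.Icc 1 ⌊P ^ 4⌋₊, 0 ≤ Complex.normSq
      (avgC (Finset.Icc 1 H) (fun h => eC ((((q : ℤ) * (h : ℤ) : ℤ) : ℝ) * θ))) :=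
    fun _ _ => Complex.normSq_nonneg _
  by_cases hW : η ≤ avgR S (fun s => Complex.normSq
      (avgC (Finset.Icc 1 T) (fun t => eC (((s * (t : ℤ) : ℤ) : ℝ) * θ))))
  · obtain ⟨q, hq0, hq1, hq2⟩ := exists_dZ_mul_le_of_le_avgR hS hη hη1 hP hPη hPL hD hT hW
    have h1 : H * dZ (((q : ℤ) : ℝ) * θ) ≤ 1 / 6 := by
      push_cast
      calc H * dZ (q * θ) ≤ H * (P ^ 8 / (T * D)) := by gcongr
        _ = H * P ^ 9 / (T * D) / P := by field_simp
        _ ≤ 1 / P := by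
          gcongr
          exact div_le_one_of_le₀ hHT (by positivity)
        _ ≤ 1 / 6 := by gcongr; linarith
    have h2 := one_fourth_le_normSq_avgC hH h1
    have h3 := Finset.single_le_sum hnn (Finset.mem_Icc.mpr ⟨hq0, Nat.le_floor hq1⟩)
    have h4 : avgR S (fun s => Complex.normSq
        (avgC (Finset.Icc 1 T) (fun t => eC (((s * (t : ℤ) : ℤ) : ℝ) * θ)))) ≤ 1 :=
      avgR_le_of_le zero_le_one fun s _ => normSq_avgC_le_one fun t _ => (norm_eC _).le
    linarith
  · linarith [Finset.sum_nonneg hnn]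

end Pointwise

section Parseval

theorem integral_eC_intCast_mul (k : ℤ) :
    ∫ θ in (0 : ℝ)..1, eC (k * θ) = if k = 0 then 1 else 0 := by
  split_ifs with hk
  · simp [hk, eC_zero]
  · have hc : (2 * Real.pi * Complex.I * k : ℂ) ≠ 0 := by
      simp [Real.pi_ne_zero, hk]
    have h1 : ∀ θ : ℝ, eC (k * θ) = Complex.exp (2 * Real.pi * Complex.I * k * θ) := by
      intro θ
      rw [eC]
      congr 1
      push_cast
      ring
    simp only [h1]
    rw [integral_exp_mul_complex hc]
    have h2 := eC_intCast k
    rw [eC] at h2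
    push_cast at h2
    simp [h2]

theorem integral_normSq_sum (W : Finset ℤ) (c : ℤ → ℂ) :
    ∫ θ in (0 : ℝ)..1, Complex.normSq (∑ n ∈ W, c n * eC (-(n * θ))) =
      ∑ n ∈ W, Complex.normSq (c n) := by
  have h1 : ∀ θ : ℝ, (Complex.normSq (∑ n ∈ W, c n * eC (-(n * θ))) : ℂ) =
      ∑ n ∈ W, ∑ m ∈ W, c n * (starRingEnd ℂ) (c m) * eC (((m - n : ℤ) : ℝ) * θ) := by
    intro θ
    rw [← Complex.mul_conj, map_sum, Finset.sum_mul_sum]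
    refine Finset.sum_congr rfl fun n _ => Finset.sum_congr rfl fun m _ => ?_
    have : ((m - n : ℤ) : ℝ) * θ = -(n * θ) + -(-(m * θ)) := by push_cast; ring
    rw [map_mul, conj_eC, this, eC_add]
    ring
  have hcont : ∀ k : ℤ, Continuous fun θ : ℝ => eC (k * θ) := fun k =>
    continuous_eC.comp (by fun_prop)
  apply Complex.ofReal_injective
  rw [← intervalIntegral.integral_ofReal]
  simp only [h1]
  rw [Complex.ofReal_sum, intervalIntegral.integral_finsetSum]
  swap
  · exact fun n _ => (continuous_finsetSum _ fun m _ =>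
      continuous_const.mul (hcont _)).intervalIntegrable _ _
  refine Finset.sum_congr rfl fun n hn => ?_
  rw [intervalIntegral.integral_finsetSum]
  swap
  · exact fun m _ => (continuous_const.mul (hcont _)).intervalIntegrable _ _
  simp only [intervalIntegral.integral_const_mul, integral_eC_intCast_mul, sub_eq_zero]
  rw [Finset.sum_eq_single_of_mem n hn fun m _ hm => by simp [hm]]
  simp [Complex.mul_conj]

theorem sum_Icc_comp_add {f : ℤ → ℂ} {B a : ℤ} (hf : ∀ m, f m ≠ 0 → |m| ≤ 2 * B) (ha : |a| ≤ B) :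
    ∑ n ∈ Finset.Icc (-(3 * B)) (3 * B), f (n + a) =
      ∑ n ∈ Finset.Icc (-(3 * B)) (3 * B), f n := by
  rw [abs_le] at ha
  refine Finset.sum_bij_ne_zero (fun n _ _ => n + a) ?_ ?_ ?_ ?_
  · intro n _ hn
    have := abs_le.mp (hf _ hn)
    exact Finset.mem_Icc.mpr ⟨by omega, by omega⟩
  · intro n _ _ m _ _ h
    exact add_right_cancel h
  · intro n _ hn
    have := abs_le.mp (hf _ hn)
    exact ⟨n - a, Finset.mem_Icc.mpr ⟨by omega, by omega⟩, by simpa using hn, by simp⟩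
  · intro n _ _
    rfl

/-- Parseval's identity for averages of translates. -/
theorem sum_normSq_avgC_eq_integral {f : ℤ → ℂ} {B : ℤ} {I : Finset ℕ} {a : ℕ → ℤ}
    (hf : ∀ m, f m ≠ 0 → |m| ≤ 2 * B) (ha : ∀ t ∈ I, |a t| ≤ B) :
    ∑ n ∈ Finset.Icc (-(3 * B)) (3 * B), Complex.normSq (avgC I (fun t => f (n + a t))) =
      ∫ θ in (0 : ℝ)..1,
        Complex.normSq (∑ n ∈ Finset.Icc (-(3 * B)) (3 * B), f n * eC (-(n * θ))) *
          Complex.normSq (avgC I (fun t => eC (a t * θ))) := by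
  rw [← integral_normSq_sum]
  congr 1; funext θ
  rw [← Complex.normSq_mul]
  congr 1
  calc _ = avgC I (fun t =>
        ∑ n ∈ Finset.Icc (-(3 * B)) (3 * B), f (n + a t) * eC (-(n * θ))) := by
        simp only [avgC, div_mul_eq_mul_div, Finset.sum_mul, ← Finset.sum_div]
        rw [Finset.sum_comm]
    _ = avgC I (fun t =>
        (∑ n ∈ Finset.Icc (-(3 * B)) (3 * B), f n * eC (-(n * θ))) * eC (a t * θ)) := by
        refine avgC_congr fun t ht => ?_
        rw [Finset.sum_mul, ← sum_Icc_comp_add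
          (f := fun n => f n * eC (-(n * θ)) * eC (a t * θ)) _ (ha t ht)]
        · refine Finset.sum_congr rfl fun n _ => ?_
          have : -((n : ℝ) * θ) = -(((n + a t : ℤ) : ℝ) * θ) + a t * θ := by push_cast; ring
          rw [this, eC_add, mul_assoc]
        · intro m hm
          exact hf m (left_ne_zero_of_mul (left_ne_zero_of_mul hm))
    _ = _ := mul_avgC _ _ _

theorem sum_avgR_normSq_le {f : ℤ → ℂ} {L L' D η P : ℝ} {S : Finset ℤ} {T H : ℕ} {B : ℤ}
    (hS : IsDiophantine L L' D S) (hη : 0 < η) (hη1 : η < 1) (hP : 8 ≤ P) (hPη : 1 ≤ P * η)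
    (hPL : (2 * L' / η) ^ L ≤ P) (hD : P ^ 5 ≤ D) (hT : P ^ 4 ≤ T) (hH : 0 < H)
    (hHT : H * P ^ 9 ≤ T * D) (hf : ∀ m, f m ≠ 0 → |m| ≤ 2 * B)
    (hSB : ∀ s ∈ S, ∀ t ∈ Finset.Icc 1 T, |s * (t : ℤ)| ≤ B)
    (hHB : ∀ q ∈ Finset.Icc 1 ⌊P ^ 4⌋₊, ∀ h ∈ Finset.Icc 1 H, |(q : ℤ) * (h : ℤ)| ≤ B) :
    ∑ n ∈ Finset.Icc (-(3 * B)) (3 * B), avgR S (fun s =>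
        Complex.normSq (avgC (Finset.Icc 1 T) (fun t => f (n + s * t)))) ≤
      η * ∑ n ∈ Finset.Icc (-(3 * B)) (3 * B), Complex.normSq (f n) +
      4 * ∑ q ∈ Finset.Icc 1 ⌊P ^ 4⌋₊, ∑ n ∈ Finset.Icc (-(3 * B)) (3 * B),
        Complex.normSq (avgC (Finset.Icc 1 H) (fun h => f (n + (q : ℤ) * h))) := by
  set F : ℝ → ℝ := fun θ =>
    Complex.normSq (∑ n ∈ Finset.Icc (-(3 * B)) (3 * B), f n * eC (-(n * θ))) with hF
  have hFc : Continuous F := Complex.continuous_normSq.comp <|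
    continuous_finsetSum _ fun n _ => continuous_const.mul (continuous_eC.comp (by fun_prop))
  have hKc : ∀ (I : Finset ℕ) (a : ℕ → ℤ),
      Continuous fun θ : ℝ => Complex.normSq (avgC I (fun t => eC (a t * θ))) := fun I a =>
    Complex.continuous_normSq.comp <| (continuous_finsetSum _ fun n _ =>
      continuous_eC.comp (by fun_prop)).div_const _
  have hlhs : ∑ n ∈ Finset.Icc (-(3 * B)) (3 * B), avgR S (fun s =>
        Complex.normSq (avgC (Finset.Icc 1 T) (fun t => f (n + s * t)))) =
      ∫ θ in (0 : ℝ)..1, F θ * avgR S (fun s => Complex.normSq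
        (avgC (Finset.Icc 1 T) (fun t => eC (((s * (t : ℤ) : ℤ) : ℝ) * θ)))) := by
    rw [← avgR_sum_comm]
    simp only [avgR, mul_div_assoc', Finset.mul_sum]
    rw [intervalIntegral.integral_div, intervalIntegral.integral_finsetSum]
    swap
    · exact fun s _ => (hFc.mul (hKc _ _)).intervalIntegrable _ _
    congr 1
    exact Finset.sum_congr rfl fun s hs => sum_normSq_avgC_eq_integral hf (hSB s hs)
  have hrhs : η * ∑ n ∈ Finset.Icc (-(3 * B)) (3 * B), Complex.normSq (f n) +
      4 * ∑ q ∈ Finset.Icc 1 ⌊P ^ 4⌋₊, ∑ n ∈ Finset.Icc (-(3 * B)) (3 * B),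
        Complex.normSq (avgC (Finset.Icc 1 H) (fun h => f (n + (q : ℤ) * h))) =
      ∫ θ in (0 : ℝ)..1, F θ * (η + 4 * ∑ q ∈ Finset.Icc 1 ⌊P ^ 4⌋₊, Complex.normSq
        (avgC (Finset.Icc 1 H) (fun h => eC ((((q : ℤ) * (h : ℤ) : ℤ) : ℝ) * θ)))) := by
    have h1 : ∀ θ, F θ * (η + 4 * ∑ q ∈ Finset.Icc 1 ⌊P ^ 4⌋₊, Complex.normSq
        (avgC (Finset.Icc 1 H) (fun h => eC ((((q : ℤ) * (h : ℤ) : ℤ) : ℝ) * θ)))) =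
        η * F θ + 4 * ∑ q ∈ Finset.Icc 1 ⌊P ^ 4⌋₊, F θ * Complex.normSq
        (avgC (Finset.Icc 1 H) (fun h => eC ((((q : ℤ) * (h : ℤ) : ℤ) : ℝ) * θ))) := by
      intro θ
      rw [← Finset.mul_sum]
      ring
    simp only [h1]
    have hqc : Continuous fun θ => ∑ q ∈ Finset.Icc 1 ⌊P ^ 4⌋₊, F θ * Complex.normSq
        (avgC (Finset.Icc 1 H) (fun h => eC ((((q : ℤ) * (h : ℤ) : ℤ) : ℝ) * θ))) :=
      continuous_finsetSum _ fun q _ => hFc.mul (hKc _ _)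
    have hηF : IntervalIntegrable (fun θ => η * F θ) MeasureTheory.volume 0 1 :=
      (continuous_const.mul hFc).intervalIntegrable _ _
    have hsum : IntervalIntegrable (fun θ => 4 * ∑ q ∈ Finset.Icc 1 ⌊P ^ 4⌋₊,
        F θ * Complex.normSq (avgC (Finset.Icc 1 H)
          (fun h => eC ((((q : ℤ) * (h : ℤ) : ℤ) : ℝ) * θ)))) MeasureTheory.volume 0 1 :=
      (continuous_const.mul hqc).intervalIntegrable _ _
    rw [intervalIntegral.integral_add hηF hsum,
      intervalIntegral.integral_const_mul, intervalIntegral.integral_const_mul,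
      intervalIntegral.integral_finsetSum, integral_normSq_sum]
    swap
    · exact fun q _ => (hFc.mul (hKc _ _)).intervalIntegrable _ _
    congr 2
    exact Finset.sum_congr rfl fun q hq => sum_normSq_avgC_eq_integral hf (hHB q hq)
  rw [hlhs, hrhs]
  refine intervalIntegral.integral_mono zero_le_one ?_ ?_ fun θ =>
    mul_le_mul_of_nonneg_left (avgR_normSq_le_add_sum hS hη hη1 hP hPη hPL hD hT hH hHT)
      (Complex.normSq_nonneg _)
  · exact (hFc.mul ((continuous_finsetSum _ fun s _ =>
      hKc _ _).div_const _)).intervalIntegrable _ _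
  · exact (hFc.mul (continuous_const.add (continuous_const.mul (continuous_finsetSum _ fun q _ =>
      hKc _ _)))).intervalIntegrable _ _

/-- One concatenation step: a box average over a diophantine family of directions is dominated by
box averages along progressions with small common difference. -/
theorem sum_avgR_boxAvg_le {g : ℤ → ℂ} {L L' D η P : ℝ} {S : Finset ℤ} {T H : ℕ} {B : ℤ}
    (hS : IsDiophantine L L' D S) (hη : 0 < η) (hη1 : η < 1) (hP : 8 ≤ P) (hPη : 1 ≤ P * η)
    (hPL : (2 * L' / η) ^ L ≤ P) (hD : P ^ 5 ≤ D) (hT : P ^ 4 ≤ T) (hH : 0 < H)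
    (hHT : H * P ^ 9 ≤ T * D) (hg : ∀ x, ‖g x‖ ≤ 1) (hgB : ∀ m, g m ≠ 0 → |m| ≤ B)
    {A : Finset ℤ} (hgA : ∀ m, g m ≠ 0 → m ∈ A)
    (hSB : ∀ s ∈ S, ∀ t ∈ Finset.Icc 1 T, |s * (t : ℤ)| ≤ B)
    (hHB : ∀ q ∈ Finset.Icc 1 ⌊P ^ 4⌋₊, ∀ h ∈ Finset.Icc 1 H, |(q : ℤ) * (h : ℤ)| ≤ B)
    {I : Finset ℕ} {a : ℕ → ℤ} (ha : ∀ t ∈ I, |a t| ≤ B) :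
    avgR S (fun s => ∑ n ∈ Finset.Icc (-(3 * B)) (3 * B),
        boxAvg (Finset.Icc 1 T) I (fun t => s * t) a g n) ≤
      η * A.card + 4 * ∑ q ∈ Finset.Icc 1 ⌊P ^ 4⌋₊, ∑ n ∈ Finset.Icc (-(3 * B)) (3 * B),
        boxAvg (Finset.Icc 1 H) I (fun h => (q : ℤ) * h) a g n := by
  have hstep : ∀ t ∈ I, ∀ t' ∈ I,
      ∑ n ∈ Finset.Icc (-(3 * B)) (3 * B), avgR S (fun s => Complex.normSq
        (avgC (Finset.Icc 1 T) (fun u => del (a t) (a t') g (n + s * u)))) ≤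
      η * A.card + 4 * ∑ q ∈ Finset.Icc 1 ⌊P ^ 4⌋₊, ∑ n ∈ Finset.Icc (-(3 * B)) (3 * B),
        Complex.normSq (avgC (Finset.Icc 1 H) (fun h => del (a t) (a t') g (n + (q : ℤ) * h))) := by
    intro t ht t' ht'
    have hsupp : ∀ m, del (a t) (a t') g m ≠ 0 → g (m + a t) ≠ 0 := fun m hm =>
      left_ne_zero_of_mul hm
    refine (sum_avgR_normSq_le hS hη hη1 hP hPη hPL hD hT hH hHT (fun m hm => ?_) hSB hHB).trans
      (add_le_add_left (mul_le_mul_of_nonneg_left ?_ hη.le) _)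
    · have h1 := abs_le.mp (hgB _ (hsupp m hm))
      have h2 := abs_le.mp (ha t ht)
      exact abs_le.mpr ⟨by omega, by omega⟩
    · classical
      calc ∑ n ∈ Finset.Icc (-(3 * B)) (3 * B), Complex.normSq (del (a t) (a t') g n)
          ≤ ∑ n ∈ Finset.Icc (-(3 * B)) (3 * B), if n + a t ∈ A then 1 else 0 := by
            refine Finset.sum_le_sum fun n _ => ?_
            split_ifs with h
            · rw [Complex.normSq_eq_norm_sq]
              exact pow_le_one₀ (norm_nonneg _) (norm_del_le_one hg _ _ _)
            · have h0 : del (a t) (a t') g n = 0 := by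
                by_contra hne
                exact h (hgA _ (hsupp n hne))
              rw [h0, map_zero]
        _ ≤ A.card := by
            rw [Finset.sum_boole]
            norm_cast
            exact Finset.card_le_card_of_injOn (fun n => n + a t)
              (fun n hn => (Finset.mem_filter.mp hn).2) (fun _ _ _ _ h => add_right_cancel h)
  calc _ = avgR I (fun t => avgR I (fun t' => ∑ n ∈ Finset.Icc (-(3 * B)) (3 * B),
        avgR S (fun s => Complex.normSq
          (avgC (Finset.Icc 1 T) (fun u => del (a t) (a t') g (n + s * u)))))) := by
        simp only [boxAvg_eq_avgR_normSq, ← avgR_sum_comm]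
        rw [avgR_comm]
        congr 1; funext t
        rw [avgR_comm]
    _ ≤ avgR I (fun t => avgR I (fun t' => η * A.card + 4 * ∑ q ∈ Finset.Icc 1 ⌊P ^ 4⌋₊,
        ∑ n ∈ Finset.Icc (-(3 * B)) (3 * B), Complex.normSq
          (avgC (Finset.Icc 1 H) (fun h => del (a t) (a t') g (n + (q : ℤ) * h))))) :=
        avgR_mono fun t ht => avgR_mono fun t' ht' => hstep t ht t' ht'
    _ ≤ η * A.card + avgR I (fun t => avgR I (fun t' => 4 * ∑ q ∈ Finset.Icc 1 ⌊P ^ 4⌋₊,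
        ∑ n ∈ Finset.Icc (-(3 * B)) (3 * B), Complex.normSq
          (avgC (Finset.Icc 1 H) (fun h => del (a t) (a t') g (n + (q : ℤ) * h))))) := by
        simp only [avgR_add]
        gcongr
        exact avgR_le_of_le (by positivity) fun _ _ => avgR_le_of_le (by positivity) fun _ _ =>
          le_rfl
    _ = _ := by simp only [avgR_const_mul, avgR_sum_comm, boxAvg_eq_avgR_normSq]

end Parseval

section Assembly

/-- One concatenation step followed by pigeonholing in the common difference. -/
theorem exists_le_avgR_boxAvg {β : Type*} {g : ℤ → ℂ} {L L' D δ P X : ℝ} {S : Finset ℤ}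
    {T H : ℕ} {B : ℤ} (hS : IsDiophantine L L' D S) (hδ : 0 < δ) (hδ1 : δ < 1) (hP : 8 ≤ P)
    (hPδ : 1 ≤ P * (δ / 4)) (hPL : (2 * L' / (δ / 4)) ^ L ≤ P) (hD : P ^ 5 ≤ D) (hT : P ^ 4 ≤ T)
    (hH : 0 < H) (hHT : H * P ^ 9 ≤ T * D) (hg : ∀ x, ‖g x‖ ≤ 1)
    (hgB : ∀ m, g m ≠ 0 → |m| ≤ B) {A : Finset ℤ} (hgA : ∀ m, g m ≠ 0 → m ∈ A)
    (hA : (A.card : ℝ) ≤ 2 * X)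
    (hSB : ∀ s ∈ S, ∀ t ∈ Finset.Icc 1 T, |s * (t : ℤ)| ≤ B)
    (hHB : ∀ q ∈ Finset.Icc 1 ⌊P ^ 4⌋₊, ∀ h ∈ Finset.Icc 1 H, |(q : ℤ) * (h : ℤ)| ≤ B)
    {V : Finset β} {I : Finset ℕ} {a : β → ℕ → ℤ} (ha : ∀ v ∈ V, ∀ t ∈ I, |a v t| ≤ B)
    (h : δ * X ≤ avgR V (fun v => avgR S (fun s => ∑ n ∈ Finset.Icc (-(3 * B)) (3 * B),
      boxAvg (Finset.Icc 1 T) I (fun t => s * t) (a v) g n))) :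
    ∃ q : ℕ, 0 < q ∧ (q : ℝ) ≤ P ^ 4 ∧
      δ / (8 * P ^ 4) * X ≤ avgR V (fun v => ∑ n ∈ Finset.Icc (-(3 * B)) (3 * B),
        boxAvg (Finset.Icc 1 H) I (fun h => (q : ℤ) * h) (a v) g n) := by
  have hP0 : 0 < P := by linarith
  have hfl : (⌊P ^ 4⌋₊ : ℝ) ≤ P ^ 4 := Nat.floor_le (by positivity)
  have hX : 0 ≤ X := by linarith [(Nat.cast_nonneg A.card : (0 : ℝ) ≤ A.card)]
  have h1 : δ * X ≤ δ / 4 * A.card + 4 * ∑ q ∈ Finset.Icc 1 ⌊P ^ 4⌋₊,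
      avgR V (fun v => ∑ n ∈ Finset.Icc (-(3 * B)) (3 * B),
        boxAvg (Finset.Icc 1 H) I (fun h => (q : ℤ) * h) (a v) g n) := by
    refine h.trans ((avgR_mono fun v hv => sum_avgR_boxAvg_le hS (by linarith) (by linarith) hP
      hPδ hPL hD hT hH hHT hg hgB hgA hSB hHB (ha v hv)).trans ?_)
    rw [avgR_add, avgR_const_mul V 4, avgR_sum_comm]
    gcongr
    exact avgR_le_of_le (by positivity) fun _ _ => le_rfl
  have h2 : ∑ _q ∈ Finset.Icc 1 ⌊P ^ 4⌋₊, δ / (8 * P ^ 4) * X ≤ ∑ q ∈ Finset.Icc 1 ⌊P ^ 4⌋₊,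
      avgR V (fun v => ∑ n ∈ Finset.Icc (-(3 * B)) (3 * B),
        boxAvg (Finset.Icc 1 H) I (fun h => (q : ℤ) * h) (a v) g n) := by
    rw [Finset.sum_const, nsmul_eq_mul, Nat.card_Icc, Nat.add_sub_cancel]
    calc (⌊P ^ 4⌋₊ : ℝ) * (δ / (8 * P ^ 4) * X) ≤ P ^ 4 * (δ / (8 * P ^ 4) * X) := by gcongr
      _ = δ * X / 8 := by field_simp
      _ ≤ _ := by
        have : δ / 4 * A.card ≤ δ / 4 * (2 * X) := by gcongr
        linarith
  have hne : (Finset.Icc 1 ⌊P ^ 4⌋₊).Nonempty := by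
    rw [Finset.nonempty_Icc]
    refine Nat.le_floor ?_
    push_cast
    exact one_le_pow₀ (by linarith)
  obtain ⟨q, hq, hle⟩ := Finset.exists_le_of_sum_le hne h2
  exact ⟨q, (Finset.mem_Icc.mp hq).1, (Nat.cast_le.mpr (Finset.mem_Icc.mp hq).2).trans hfl, hle⟩

/-- Restriction of a function to a finite set, extended by zero. -/
def restrictTo (A : Finset ℤ) (f : ℤ → ℂ) : ℤ → ℂ := fun m => if m ∈ A then f m else 0

theorem restrictTo_of_mem {A : Finset ℤ} {f : ℤ → ℂ} {m : ℤ} (h : m ∈ A) :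
    restrictTo A f m = f m := if_pos h

theorem restrictTo_of_notMem {A : Finset ℤ} {f : ℤ → ℂ} {m : ℤ} (h : m ∉ A) :
    restrictTo A f m = 0 := if_neg h

theorem mem_of_restrictTo_ne_zero {A : Finset ℤ} {f : ℤ → ℂ} {m : ℤ} (h : restrictTo A f m ≠ 0) :
    m ∈ A := by
  by_contra hm
  exact h (restrictTo_of_notMem hm)

theorem norm_restrictTo_le_one {f : ℤ → ℂ} (hf : ∀ x, ‖f x‖ ≤ 1) (A : Finset ℤ) (x : ℤ) :
    ‖restrictTo A f x‖ ≤ 1 := by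
  rw [restrictTo]
  split_ifs
  · exact hf x
  · simp

theorem boxAvg_zero (I₁ I₂ : Finset ℕ) (a₁ a₂ : ℕ → ℤ) (n : ℤ) :
    boxAvg I₁ I₂ a₁ a₂ (fun _ => 0) n = 0 := by
  simp [boxAvg, del, avgC]

theorem sum_Icc_natCast_eq (m k : ℕ) (f : ℤ → ℝ) :
    ∑ n ∈ Finset.Icc m k, f (n : ℤ) = ∑ n ∈ Finset.Icc (m : ℤ) k, f n := by
  refine Finset.sum_bij (fun n _ => (n : ℤ)) ?_ ?_ ?_ fun _ _ => rfl
  · intro n hn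
    rw [Finset.mem_Icc] at hn ⊢
    omega
  · intro n _ n' _ h
    exact_mod_cast h
  · intro n hn
    rw [Finset.mem_Icc] at hn
    exact ⟨n.toNat, Finset.mem_Icc.mpr ⟨by omega, by omega⟩, by simp; omega⟩

/-- Removing the truncation of a function in a box average costs only the boundary terms. -/
theorem sum_boxAvg_restrictTo_le {f : ℤ → ℂ} (hf : ∀ x, ‖f x‖ ≤ 1) {X R M : ℕ} (hR : R < X)
    {I₁ I₂ : Finset ℕ} {a₁ a₂ : ℕ → ℤ}
    (h0 : ∀ t₁ ∈ I₁, ∀ t₂ ∈ I₂, 0 ≤ a₁ t₁ + a₂ t₂)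
    (hM : ∀ t₁ ∈ I₁, ∀ t₂ ∈ I₂, a₁ t₁ + a₂ t₂ ≤ M) (W : Finset ℤ) :
    ∑ n ∈ W, boxAvg I₁ I₂ a₁ a₂ (restrictTo (Finset.Icc ((X : ℤ) - R) (2 * X + R)) f) n ≤
      ∑ n ∈ Finset.Icc 1 (2 * X), boxAvg I₁ I₂ a₁ a₂ f (n : ℤ) + (2 * M + R) := by
  set bad : Finset ℤ := Finset.Ico ((X : ℤ) - R - M) (X - R) ∪
    Finset.Ioc (2 * (X : ℤ) - M) (2 * X + R) with hbad
  have hpt : ∀ n ∈ W,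
      boxAvg I₁ I₂ a₁ a₂ (restrictTo (Finset.Icc ((X : ℤ) - R) (2 * X + R)) f) n ≤
      (if n ∈ Finset.Icc (1 : ℤ) (2 * X) then boxAvg I₁ I₂ a₁ a₂ f n else 0) +
        (if n ∈ bad then 1 else 0) := by
    intro n _
    have hnn : 0 ≤ if n ∈ Finset.Icc (1 : ℤ) (2 * X) then boxAvg I₁ I₂ a₁ a₂ f n else 0 := by
      split_ifs
      · exact boxAvg_nonneg _ _ _ _ _ _
      · exact le_rfl
    by_cases hn : n ∈ bad
    · rw [if_pos hn]
      linarith [boxAvg_le_one (norm_restrictTo_le_one hf (Finset.Icc ((X : ℤ) - R) (2 * X + R)))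
        I₁ I₂ a₁ a₂ n]
    · rw [if_neg hn, add_zero]
      simp only [hbad, Finset.mem_union, Finset.mem_Ico, Finset.mem_Ioc, not_or, not_and,
        not_lt, not_le] at hn
      by_cases hin : (X : ℤ) - R ≤ n ∧ n ≤ 2 * X - M
      · rw [if_pos (Finset.mem_Icc.mpr ⟨by omega, by omega⟩)]
        refine (boxAvg_congr fun t₁ ht₁ t₂ ht₂ => restrictTo_of_mem ?_).le
        have h1 := h0 t₁ ht₁ t₂ ht₂
        have h2 := hM t₁ ht₁ t₂ ht₂
        exact Finset.mem_Icc.mpr ⟨by omega, by omega⟩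
      · refine le_trans (le_of_eq ?_) hnn
        rw [← boxAvg_zero I₁ I₂ a₁ a₂ n]
        refine boxAvg_congr fun t₁ ht₁ t₂ ht₂ => restrictTo_of_notMem ?_
        have h1 := h0 t₁ ht₁ t₂ ht₂
        have h2 := hM t₁ ht₁ t₂ ht₂
        rw [Finset.mem_Icc]
        omega
  refine (Finset.sum_le_sum hpt).trans ?_
  rw [Finset.sum_add_distrib]
  gcongr
  · rw [sum_Icc_natCast_eq 1 (2 * X), ← Finset.sum_filter]
    refine Finset.sum_le_sum_of_subset_of_nonneg (fun n hn => ?_)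
      fun _ _ _ => boxAvg_nonneg _ _ _ _ _ _
    simpa using (Finset.mem_filter.mp hn).2
  · rw [Finset.sum_boole]
    have h1 : (W.filter (fun n => n ∈ bad)).card ≤ bad.card :=
      Finset.card_le_card fun n hn => (Finset.mem_filter.mp hn).2
    have h2 : bad.card ≤ 2 * M + R := by
      refine (Finset.card_union_le _ _).trans ?_
      rw [Int.card_Ico, Int.card_Ioc]
      omega
    exact_mod_cast h1.trans h2

theorem avgC_four_comm {α β γ : Type*} (I : Finset α) (J : Finset β) (S : Finset γ)
    (F : α → α → β → β → γ → ℂ) :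
    avgC I (fun t => avgC I (fun t' => avgC J (fun u => avgC J (fun u' =>
      avgC S (fun s => F t t' u u' s))))) =
    avgC S (fun s => avgC I (fun t => avgC I (fun t' => avgC J (fun u => avgC J (fun u' =>
      F t t' u u' s))))) := by
  simp only [avgC_comm _ S]

theorem norm_ext0_le_one {ψ : ℕ → ℂ} (hψ : ∀ n, ‖ψ n‖ ≤ 1) (m : ℤ) : ‖ext0 ψ m‖ ≤ 1 := by
  rw [ext0]
  split_ifs
  · exact hψ _
  · simp

/-- Lower bound for the truncated box sums over all integers. -/
theorem mul_le_avgR_sum_boxAvg {f : ℤ → ℂ} {δ : ℝ} {S₁ S₂ : Finset ℤ} {T₁ T₂ X R : ℕ} {B : ℤ}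
    (hX : 0 < X) (hB : 2 * (X : ℤ) ≤ 3 * B)
    (hR : ∀ s₁ ∈ S₁, ∀ t₁ ∈ Finset.Icc 1 T₁, ∀ s₂ ∈ S₂, ∀ t₂ ∈ Finset.Icc 1 T₂,
      |s₁ * (t₁ : ℤ) + s₂ * (t₂ : ℤ)| ≤ R)
    (h : δ ≤ (avgC (Finset.Ico X (2 * X)) (fun n =>
      avgC (Finset.Icc 1 T₁) (fun t₁ => avgC (Finset.Icc 1 T₁) (fun t₁' =>
      avgC (Finset.Icc 1 T₂) (fun t₂ => avgC (Finset.Icc 1 T₂) (fun t₂' =>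
      avgC S₁ (fun s₁ => avgC S₂ (fun s₂ =>
        del (s₁ * (t₁ : ℤ)) (s₁ * (t₁' : ℤ))
          (del (s₂ * (t₂ : ℤ)) (s₂ * (t₂' : ℤ)) f) (n : ℤ))))))))).re) :
    δ * X ≤ avgR S₂ (fun s₂ => avgR S₁ (fun s₁ => ∑ n ∈ Finset.Icc (-(3 * B)) (3 * B),
      boxAvg (Finset.Icc 1 T₁) (Finset.Icc 1 T₂) (fun t => s₁ * t) (fun t => s₂ * t)
        (restrictTo (Finset.Icc ((X : ℤ) - R) (2 * X + R)) f) n)) := by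
  have hXpos : (0 : ℝ) < X := by exact_mod_cast hX
  set φ : (ℤ → ℂ) → ℤ → ℝ := fun g n => avgR S₁ (fun s₁ => avgR S₂ (fun s₂ =>
    boxAvg (Finset.Icc 1 T₁) (Finset.Icc 1 T₂) (fun t => s₁ * t) (fun t => s₂ * t) g n)) with hφ
  have hφ0 : ∀ g n, 0 ≤ φ g n := fun g n => avgR_nonneg fun _ _ => avgR_nonneg fun _ _ =>
    boxAvg_nonneg _ _ _ _ _ _
  have h1 : δ ≤ avgR (Finset.Ico X (2 * X)) (fun n => φ f (n : ℤ)) := by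
    refine h.trans (le_of_eq ?_)
    rw [avgC_re]
    congr 1; funext n
    rw [avgC_four_comm, avgC_re]
    simp only [hφ]
    congr 1; funext s₁
    rw [avgC_four_comm, avgC_re]
    rfl
  rw [avgR, Nat.card_Ico, show 2 * X - X = X by omega, le_div_iff₀ hXpos] at h1
  set g := restrictTo (Finset.Icc ((X : ℤ) - R) (2 * X + R)) f
  calc δ * X ≤ ∑ n ∈ Finset.Ico X (2 * X), φ f (n : ℤ) := h1
    _ ≤ ∑ n ∈ Finset.Ico X (2 * X), φ g (n : ℤ) := by
      refine Finset.sum_le_sum fun n hn => avgR_mono fun s₁ hs₁ => avgR_mono fun s₂ hs₂ =>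
        (boxAvg_congr fun t₁ ht₁ t₂ ht₂ => (restrictTo_of_mem ?_).symm).le
      have h2 := abs_le.mp (hR s₁ hs₁ t₁ ht₁ s₂ hs₂ t₂ ht₂)
      rw [Finset.mem_Ico] at hn
      exact Finset.mem_Icc.mpr ⟨by omega, by omega⟩
    _ ≤ ∑ n ∈ Finset.Icc X (2 * X), φ g (n : ℤ) :=
      Finset.sum_le_sum_of_subset_of_nonneg Finset.Ico_subset_Icc_self fun _ _ _ => hφ0 _ _
    _ = ∑ n ∈ Finset.Icc (X : ℤ) (2 * X : ℕ), φ g n := sum_Icc_natCast_eq _ _ _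
    _ ≤ ∑ n ∈ Finset.Icc (-(3 * B)) (3 * B), φ g n :=
      Finset.sum_le_sum_of_subset_of_nonneg
        (Finset.Icc_subset_Icc (by omega) (by push_cast; omega)) fun _ _ _ => hφ0 _ _
    _ = _ := by
      simp only [hφ]
      rw [← avgR_sum_comm]
      simp only [← avgR_sum_comm]
      rw [avgR_comm]

end Assembly

section Main

theorem abs_mul_natCast_le {s : ℤ} {t T : ℕ} {c : ℝ} (hs : |(s : ℝ)| ≤ c)
    (ht : t ∈ Finset.Icc 1 T) : |(s : ℝ) * t| ≤ c * T := by
  rw [abs_mul, Nat.abs_cast]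
  have h1 : (t : ℝ) ≤ T := by exact_mod_cast (Finset.mem_Icc.mp ht).2
  have h0 := (abs_nonneg _).trans hs
  gcongr

theorem abs_mul_natCast_le_of_le {s : ℤ} {t T : ℕ} {c x : ℝ} {B : ℤ} (hs : |(s : ℝ)| ≤ c)
    (ht : t ∈ Finset.Icc 1 T) (hc : c * T ≤ x) (hB : x ≤ B) : |s * (t : ℤ)| ≤ B := by
  have h : ((|s * (t : ℤ)| : ℤ) : ℝ) ≤ B := by
    push_cast
    exact (abs_mul_natCast_le hs ht).trans (hc.trans hB)
  exact_mod_cast h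

set_option maxHeartbeats 1000000 in
/-- The iterated inverse theorem, with explicit powers of auxiliary parameters `Z ≤ Y`. -/
theorem exists_le_sum_boxAvg {δ L L' D₁ D₂ Z Y : ℝ} {S₁ S₂ : Finset ℤ} {T₁ T₂ X H₁ H₂ : ℕ}
    {f : ℤ → ℂ} (hδ : 0 < δ) (hδ1 : δ < 1) (hδZ : 1 ≤ δ * Z) (hZ : 100 ≤ Z) (hZY : Z ≤ Y)
    (hL₁ : (2 * L' / (δ / 4)) ^ L ≤ Z ^ 2)
    (hL₂ : (2 * L' / (δ / (8 * (Z ^ 2) ^ 4) / 4)) ^ L ≤ Y ^ 10)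
    (hs₁ : ∀ s ∈ S₁, |(s : ℝ)| ≤ 4 * D₁) (hs₂ : ∀ s ∈ S₂, |(s : ℝ)| ≤ 4 * D₂)
    (hS₁ : IsDiophantine L L' D₁ S₁) (hS₂ : IsDiophantine L L' D₂ S₂)
    (hD₁ : Y ^ 100 ≤ D₁) (hD₂ : Y ^ 100 ≤ D₂) (hT₁ : Y ^ 100 ≤ T₁) (hT₂ : Y ^ 100 ≤ T₂)
    (hX₁ : T₁ * D₁ * Y ^ 100 ≤ X) (hX₂ : T₂ * D₂ * Y ^ 100 ≤ X) (hH₁ : 0 < H₁) (hH₂ : 0 < H₂)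
    (hHT₁ : H₁ * Y ^ 100 ≤ T₁ * D₁) (hHT₂ : H₂ * Y ^ 100 ≤ T₂ * D₂) (hf : ∀ x, ‖f x‖ ≤ 1)
    (h : δ ≤ (avgC (Finset.Ico X (2 * X)) (fun n =>
      avgC (Finset.Icc 1 T₁) (fun t₁ => avgC (Finset.Icc 1 T₁) (fun t₁' =>
      avgC (Finset.Icc 1 T₂) (fun t₂ => avgC (Finset.Icc 1 T₂) (fun t₂' =>
      avgC S₁ (fun s₁ => avgC S₂ (fun s₂ =>
        del (s₁ * (t₁ : ℤ)) (s₁ * (t₁' : ℤ))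
          (del (s₂ * (t₂ : ℤ)) (s₂ * (t₂' : ℤ)) f) (n : ℤ))))))))).re) :
    ∃ q₁ q₂ : ℕ, 0 < q₁ ∧ 0 < q₂ ∧ (q₁ : ℝ) ≤ Z ^ 8 ∧ (q₂ : ℝ) ≤ Y ^ 40 ∧
      2 * X ≤ Y ^ 100 * ∑ n ∈ Finset.Icc 1 (2 * X), boxAvg (Finset.Icc 1 H₁) (Finset.Icc 1 H₂)
        (fun h => (q₁ : ℤ) * h) (fun h => (q₂ : ℤ) * h) f (n : ℤ) := by
  have hZ1 : 1 ≤ Z := by linarith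
  have hY : 100 ≤ Y := by linarith
  have hY1 : 1 ≤ Y := by linarith
  have hZ0 : 0 < Z := by linarith
  have hY0 : 0 < Y := by linarith
  have hpow : ∀ {m k : ℕ}, m ≤ k → Y ^ m ≤ Y ^ k := fun hmk => pow_le_pow_right₀ hY1 hmk
  have hZpow : ∀ {m k : ℕ}, m ≤ k → Z ^ m ≤ Y ^ k := fun {m k} hmk =>
    (pow_le_pow_left₀ hZ0.le hZY m).trans (hpow hmk)
  have hδY : 1 ≤ δ * Y := hδZ.trans (by gcongr)
  have hE : (100 : ℝ) ≤ Y ^ 100 := hY.trans (by simpa using hpow (m := 1) (k := 100) (by norm_num))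
  have hE2 : (10000 : ℝ) ≤ Y ^ 2 := by nlinarith
  have hTD₁ : 1 ≤ (T₁ : ℝ) * D₁ := by nlinarith
  have hTD₂ : 1 ≤ (T₂ : ℝ) * D₂ := by nlinarith
  have hX₁' : T₁ * D₁ * 100 ≤ (X : ℝ) := le_trans (by gcongr) hX₁
  have hX₂' : T₂ * D₂ * 100 ≤ (X : ℝ) := le_trans (by gcongr) hX₂
  have hX0 : (0 : ℝ) < X := by linarith
  have hXpos : 0 < X := by exact_mod_cast hX0
  set R : ℕ := ⌊4 * (T₁ * D₁) + 4 * (T₂ * D₂)⌋₊ with hRdef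
  have hR : (R : ℝ) ≤ 4 * (T₁ * D₁) + 4 * (T₂ * D₂) := Nat.floor_le (by linarith)
  have hRX : (R : ℝ) * Y ^ 100 ≤ 8 * X := by
    calc (R : ℝ) * Y ^ 100 ≤ (4 * (T₁ * D₁) + 4 * (T₂ * D₂)) * Y ^ 100 := by gcongr
      _ ≤ 8 * (X : ℝ) := by linarith
  have hR2 : 2 * R + 1 ≤ X := by
    have : (2 * R + 1 : ℝ) ≤ X := by linarith
    exact_mod_cast this
  set B : ℤ := 4 * X with hB
  have hXB : (X : ℝ) ≤ B := by rw [hB]; push_cast; linarith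
  set A := Finset.Icc ((X : ℤ) - R) (2 * X + R) with hA
  set g := restrictTo A f with hg
  have hg1 : ∀ x, ‖g x‖ ≤ 1 := norm_restrictTo_le_one hf A
  have hgA : ∀ m, g m ≠ 0 → m ∈ A := fun m => mem_of_restrictTo_ne_zero
  have hgB : ∀ m, g m ≠ 0 → |m| ≤ B := fun m hm => by
    have := Finset.mem_Icc.mp (hgA m hm)
    rw [abs_le]
    omega
  have hAcard : (A.card : ℝ) ≤ 2 * X := by
    have : A.card ≤ 2 * X := by rw [hA, Int.card_Icc]; omega
    exact_mod_cast this
  have hSB₁ : ∀ s ∈ S₁, ∀ t ∈ Finset.Icc 1 T₁, |s * (t : ℤ)| ≤ B := fun s hs t ht =>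
    abs_mul_natCast_le_of_le (hs₁ s hs) ht (by linarith) hXB
  have hSB₂ : ∀ s ∈ S₂, ∀ t ∈ Finset.Icc 1 T₂, |s * (t : ℤ)| ≤ B := fun s hs t ht =>
    abs_mul_natCast_le_of_le (hs₂ s hs) ht (by linarith) hXB
  have hHX : ∀ {q H T : ℕ} {D : ℝ}, (q : ℝ) ≤ Y ^ 40 → H * Y ^ 100 ≤ T * D →
      T * D * Y ^ 100 ≤ X → (q * H : ℝ) * Y ^ 60 * Y ^ 100 ≤ X := by
    intro q H T D hq hH hT
    calc (q * H : ℝ) * Y ^ 60 * Y ^ 100 ≤ (Y ^ 40 * H) * Y ^ 60 * Y ^ 100 := by gcongr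
      _ = H * Y ^ 100 * Y ^ 100 := by ring
      _ ≤ T * D * Y ^ 100 := by gcongr
      _ ≤ X := hT
  have hHB : ∀ {q H T h : ℕ} {D : ℝ}, (q : ℝ) ≤ Y ^ 40 → H * Y ^ 100 ≤ T * D →
      T * D * Y ^ 100 ≤ X → h ∈ Finset.Icc 1 H → |(q : ℤ) * (h : ℤ)| ≤ B := by
    intro q H T h D hq hH hT hh
    refine abs_mul_natCast_le_of_le (c := q) (by simp) hh (x := X) ?_ hXB
    have h1 := hHX hq hH hT
    have h2 : (q * H : ℝ) * 1 * 1 ≤ q * H * Y ^ 60 * Y ^ 100 := by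
      gcongr <;> exact one_le_pow₀ hY1
    linarith
  have h0 := mul_le_avgR_sum_boxAvg (R := R) (B := B) hXpos (by omega)
    (fun s₁ h₁ t₁ ht₁ s₂ h₂ t₂ ht₂ => by
      have h3 : |s₁ * (t₁ : ℤ) + s₂ * (t₂ : ℤ)|.toNat ≤ R := by
        refine Nat.le_floor ?_
        have h4 : ((|s₁ * (t₁ : ℤ) + s₂ * (t₂ : ℤ)|.toNat : ℤ) : ℝ) =
            |(s₁ : ℝ) * t₁ + s₂ * t₂| := by
          rw [Int.toNat_of_nonneg (abs_nonneg _)]; push_cast; rfl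
        rw [Int.cast_natCast] at h4
        rw [h4]
        have h5 := abs_add_le ((s₁ : ℝ) * t₁) (s₂ * t₂)
        have h6 := abs_mul_natCast_le (hs₁ s₁ h₁) ht₁
        have h7 := abs_mul_natCast_le (hs₂ s₂ h₂) ht₂
        linarith
      omega) h
  obtain ⟨q₁, hq₁, hq₁Z, h1⟩ := exists_le_avgR_boxAvg (P := Z ^ 2) (H := H₁) hS₁ hδ hδ1
    (by nlinarith) (by nlinarith) hL₁ (le_trans (by rw [← pow_mul]; exact hZpow (by norm_num)) hD₁)
    (le_trans (by rw [← pow_mul]; exact hZpow (by norm_num)) hT₁) hH₁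
    (le_trans (by rw [← pow_mul]; gcongr; exact hZpow (by norm_num)) hHT₁) hg1 hgB hgA hAcard hSB₁
    (fun q hq h hh => hHB (le_trans
      ((Nat.cast_le.mpr (Finset.mem_Icc.mp hq).2).trans (Nat.floor_le (by positivity)))
      (by rw [← pow_mul]; exact hZpow (by norm_num))) hHT₁ hX₁ hh)
    (a := fun s t => s * t) hSB₂ h0
  rw [← pow_mul] at hq₁Z
  have hq₁Y : (q₁ : ℝ) ≤ Y ^ 40 := hq₁Z.trans (hZpow (by norm_num))
  set δ₂ := δ / (8 * (Z ^ 2) ^ 4) with hδ₂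
  have hδ₂0 : 0 < δ₂ := by positivity
  have hδ₂Z : δ₂ * (8 * Z ^ 8) = δ := by rw [hδ₂]; field_simp
  have hδ₂Y : 100 ≤ δ₂ * (8 * Y ^ 10) := by
    calc (100 : ℝ) ≤ 1 * Y := by linarith
      _ ≤ (δ * Y) * Y := by gcongr
      _ = δ₂ * (8 * (Z ^ 8 * Y ^ 2)) := by rw [← hδ₂Z]; ring
      _ ≤ δ₂ * (8 * (Y ^ 8 * Y ^ 2)) := by gcongr
      _ = δ₂ * (8 * Y ^ 10) := by ring
  have hδ₂1 : δ₂ < 1 := by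
    refine lt_of_le_of_lt (div_le_self hδ.le ?_) hδ1
    have : 1 ≤ (Z ^ 2) ^ 4 := one_le_pow₀ (one_le_pow₀ hZ1)
    linarith
  have h1' : δ₂ * X ≤ avgR {()} (fun _ => avgR S₂ (fun s => ∑ n ∈ Finset.Icc (-(3 * B)) (3 * B),
      boxAvg (Finset.Icc 1 T₂) (Finset.Icc 1 H₁) (fun t => s * t) (fun h => (q₁ : ℤ) * h)
        g n)) := by
    refine h1.trans (le_of_eq ?_)
    simp only [boxAvg_comm (Finset.Icc 1 H₁)]
    simp [avgR]
  obtain ⟨q₂, hq₂, hq₂Y, h2⟩ := exists_le_avgR_boxAvg (P := Y ^ 10) (H := H₂) hS₂ hδ₂0 hδ₂1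
    (by have := hpow (m := 2) (k := 10) (by norm_num); linarith) (by linarith) hL₂
    (le_trans (by rw [← pow_mul]; exact hpow (by norm_num)) hD₂)
    (le_trans (by rw [← pow_mul]; exact hpow (by norm_num)) hT₂) hH₂
    (le_trans (by
      rw [← pow_mul]
      exact mul_le_mul_of_nonneg_left (hpow (by norm_num)) H₂.cast_nonneg) hHT₂)
    hg1 hgB hgA hAcard hSB₂
    (fun q hq h hh => hHB (le_trans
      ((Nat.cast_le.mpr (Finset.mem_Icc.mp hq).2).trans (Nat.floor_le (by positivity)))
      (by rw [← pow_mul])) hHT₂ hX₂ hh)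
    (a := fun _ h => (q₁ : ℤ) * h) (fun _ _ h hh => hHB hq₁Y hHT₁ hX₁ hh) h1'
  rw [← pow_mul] at hq₂Y
  refine ⟨q₁, q₂, hq₁, hq₂, hq₁Z, hq₂Y, ?_⟩
  have h3 : δ₂ / (8 * (Y ^ 10) ^ 4) * X ≤ ∑ n ∈ Finset.Icc (-(3 * B)) (3 * B),
      boxAvg (Finset.Icc 1 H₁) (Finset.Icc 1 H₂) (fun h => (q₁ : ℤ) * h) (fun h => (q₂ : ℤ) * h)
        g n := by
    refine h2.trans (le_of_eq ?_)
    simp only [boxAvg_comm (Finset.Icc 1 H₂)]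
    simp [avgR]
  have h4 := sum_boxAvg_restrictTo_le hf (X := X) (R := R) (M := q₁ * H₁ + q₂ * H₂) (by omega)
    (I₁ := Finset.Icc 1 H₁) (I₂ := Finset.Icc 1 H₂) (a₁ := fun h => (q₁ : ℤ) * h)
    (a₂ := fun h => (q₂ : ℤ) * h) (fun _ _ _ _ => by positivity)
    (fun t₁ ht₁ t₂ ht₂ => by
      push_cast
      rw [Finset.mem_Icc] at ht₁ ht₂
      gcongr <;> omega) (Finset.Icc (-(3 * B)) (3 * B))
  set W := ∑ n ∈ Finset.Icc 1 (2 * X), boxAvg (Finset.Icc 1 H₁) (Finset.Icc 1 H₂)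
        (fun h => (q₁ : ℤ) * h) (fun h => (q₂ : ℤ) * h) f (n : ℤ)
  have h5 := h3.trans h4
  push_cast at h5
  have h6 : 12 * (X : ℝ) ≤ Y ^ 100 * (δ₂ / (8 * (Y ^ 10) ^ 4) * X) := by
    have : (12 : ℝ) ≤ Y ^ 100 * (δ₂ / (8 * (Y ^ 10) ^ 4)) := by
      calc (12 : ℝ) ≤ 100 / 64 * Y := by linarith
        _ ≤ (δ₂ * (8 * Y ^ 10)) / 64 * Y := by gcongr
        _ = Y ^ 11 * (δ₂ / 8) := by ring
        _ ≤ Y ^ 60 * (δ₂ / 8) := by gcongr ?_ * _; exact hpow (by norm_num)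
        _ = Y ^ 100 * (δ₂ / (8 * (Y ^ 10) ^ 4)) := by field_simp
    nlinarith
  have h7 : ∀ {x : ℝ}, 0 ≤ x → x * Y ^ 60 * Y ^ 100 ≤ X → x * Y ^ 100 ≤ X / 2 := by
    intro x hx hle
    have hY60 : (2 : ℝ) ≤ Y ^ 60 := by
      have := hpow (m := 2) (k := 60) (by norm_num)
      linarith
    have : x * 2 * Y ^ 100 ≤ x * Y ^ 60 * Y ^ 100 := by gcongr
    linarith
  have h8 := h7 (by positivity) (hHX hq₁Y hHT₁ hX₁)
  have h9 := h7 (by positivity) (hHX hq₂Y hHT₂ hX₂)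
  have h10 := mul_le_mul_of_nonneg_left h5 (by positivity : 0 ≤ Y ^ 100)
  linarith

end Main

/-- Lemma 2.6 of the paper, iterated variant. -/
theorem inverse_concat_iterated :
    ∃ δ₀ : ℝ, δ₀ ∈ Set.Ioo (0 : ℝ) 1 ∧ ∃ C : ℝ, 1 ≤ C ∧ ∃ X₀ : ℕ,
      ∀ (δ L L' D₁ D₂ : ℝ) (S₁ S₂ : Finset ℤ) (T₁ T₂ X H₁ H₂ : ℕ) (ψ : ℕ → ℂ),
        0 < δ → δ ≤ δ₀ → 1 ≤ L → 1 ≤ L' → 1 ≤ D₁ → 1 ≤ D₂ →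
        S₁.Nonempty → S₂.Nonempty →
        (∀ s ∈ S₁, |(s : ℝ)| ≤ 4 * D₁) → (∀ s ∈ S₂, |(s : ℝ)| ≤ 4 * D₂) →
        IsDiophantine L L' D₁ S₁ → IsDiophantine L L' D₂ S₂ →
        X₀ ≤ X →
        (L' / δ) ^ (C * L ^ 2) ≤ D₁ → (L' / δ) ^ (C * L ^ 2) ≤ D₂ →
        (L' / δ) ^ (C * L ^ 2) ≤ (T₁ : ℝ) → (L' / δ) ^ (C * L ^ 2) ≤ (T₂ : ℝ) →
        (T₁ : ℝ) * D₁ ≤ (δ / L') ^ (C * L ^ 2) * X →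
        (T₂ : ℝ) * D₂ ≤ (δ / L') ^ (C * L ^ 2) * X →
        0 < H₁ → 0 < H₂ →
        (H₁ : ℝ) ≤ (δ / L') ^ (C * L ^ 2) * T₁ * D₁ →
        (H₂ : ℝ) ≤ (δ / L') ^ (C * L ^ 2) * T₂ * D₂ →
        (∀ n, ‖ψ n‖ ≤ 1) →
        δ ≤ (avgC (Finset.Ico X (2 * X)) (fun n =>
              avgC (Finset.Icc 1 T₁) (fun t₁ => avgC (Finset.Icc 1 T₁) (fun t₁' =>
              avgC (Finset.Icc 1 T₂) (fun t₂ => avgC (Finset.Icc 1 T₂) (fun t₂' =>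
              avgC S₁ (fun s₁ => avgC S₂ (fun s₂ =>
                del (s₁ * (t₁ : ℤ)) (s₁ * (t₁' : ℤ))
                  (del (s₂ * (t₂ : ℤ)) (s₂ * (t₂' : ℤ)) (ext0 ψ)) (n : ℤ))))))))).re →
        ∃ q₁ q₂ : ℕ, 0 < q₁ ∧ 0 < q₂ ∧
          (q₁ : ℝ) ≤ (L' / δ) ^ (C * L ^ 2) ∧ (q₂ : ℝ) ≤ (L' / δ) ^ (C * L ^ 2) ∧
          (δ / L') ^ (C * L ^ 2) ≤ (avgC (Finset.Icc 1 (2 * X)) (fun n =>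
              avgC (Finset.Icc 1 H₁) (fun h₁ => avgC (Finset.Icc 1 H₁) (fun h₁' =>
              avgC (Finset.Icc 1 H₂) (fun h₂ => avgC (Finset.Icc 1 H₂) (fun h₂' =>
                del ((q₁ : ℤ) * (h₁ : ℤ)) ((q₁ : ℤ) * (h₁' : ℤ))
                  (del ((q₂ : ℤ) * (h₂ : ℤ)) ((q₂ : ℤ) * (h₂' : ℤ)) (ext0 ψ))
                    (n : ℤ))))))).re := by
  refine ⟨1 / 100, ⟨by norm_num, by norm_num⟩, 100, by norm_num, 0, ?_⟩
  intro δ L L' D₁ D₂ S₁ S₂ T₁ T₂ X H₁ H₂ ψ hδ hδ0 hL hL' _ _ _ _ hs₁ hs₂ hS₁ hS₂ _ hD₁ hD₂ hT₁ hT₂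
    hX₁ hX₂ hH₁ hH₂ hHT₁ hHT₂ hψ h
  set y := L' / δ with hy
  have hL'0 : 0 < L' := by linarith
  have hy100 : 100 ≤ y := by rw [hy, le_div_iff₀ hδ]; linarith
  have hy0 : 0 < y := by linarith
  have hy1 : 1 ≤ y := by linarith
  have hL0 : 0 ≤ L := by linarith
  have hE : y ^ (100 * L ^ 2) = (y ^ L ^ 2) ^ 100 := by
    rw [mul_comm, Real.rpow_mul hy0.le, ← Real.rpow_natCast]
    norm_num
  have hEinv : (δ / L') ^ (100 * L ^ 2) = ((y ^ L ^ 2) ^ 100)⁻¹ := by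
    rw [← hE, ← Real.inv_rpow hy0.le, hy, inv_div]
  have hyZ : y ≤ y ^ L := by simpa using Real.rpow_le_rpow_of_exponent_le hy1 hL
  have hZY : y ^ L ≤ y ^ L ^ 2 := Real.rpow_le_rpow_of_exponent_le hy1 (by nlinarith)
  have hZ0 : 0 < y ^ L := by positivity
  have hY : (y ^ L) ^ L = y ^ L ^ 2 := by rw [← Real.rpow_mul hy0.le, sq]
  have hδy : 1 ≤ δ * y := by rw [hy, mul_div_cancel₀ _ hδ.ne']; exact hL'
  rw [hE] at hD₁ hD₂ hT₁ hT₂ ⊢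
  rw [hEinv] at hX₁ hX₂ hHT₁ hHT₂ ⊢
  set Y := y ^ L ^ 2 with hYdef
  set Z := y ^ L with hZdef
  have hY1 : 1 ≤ Y := by linarith
  have hYpos : 0 < Y ^ 100 := by positivity
  have hL₁ : (2 * L' / (δ / 4)) ^ L ≤ Z ^ 2 := by
    rw [show 2 * L' / (δ / 4) = 8 * y by rw [hy]; field_simp; norm_num, hZdef,
      Real.rpow_pow_comm hy0.le]
    exact Real.rpow_le_rpow (by positivity) (by nlinarith) hL0
  have hL₂ : (2 * L' / (δ / (8 * (Z ^ 2) ^ 4) / 4)) ^ L ≤ Y ^ 10 := by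
    rw [show 2 * L' / (δ / (8 * (Z ^ 2) ^ 4) / 4) = 64 * y * Z ^ 8 by
      rw [hy]; field_simp; norm_num, ← hY, Real.rpow_pow_comm hZ0.le]
    refine Real.rpow_le_rpow (by positivity) ?_ hL0
    calc 64 * y * Z ^ 8 ≤ Z * Z * Z ^ 8 := by gcongr; linarith
      _ = Z ^ 10 := by ring
  have hdiv : ∀ {a b : ℝ}, a ≤ (Y ^ 100)⁻¹ * b → a * Y ^ 100 ≤ b := fun {a b} hab => by
    rwa [inv_mul_eq_div, le_div_iff₀ hYpos] at hab
  rw [mul_assoc] at hHT₁ hHT₂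
  obtain ⟨q₁, q₂, hq₁, hq₂, hq₁Z, hq₂Y, hle⟩ := exists_le_sum_boxAvg hδ (by linarith)
    (hδy.trans (by gcongr)) (hy100.trans hyZ) hZY hL₁ hL₂ hs₁ hs₂ hS₁ hS₂ hD₁ hD₂ hT₁ hT₂
    (hdiv hX₁) (hdiv hX₂) hH₁ hH₂ (hdiv hHT₁) (hdiv hHT₂) (norm_ext0_le_one hψ) h
  refine ⟨q₁, q₂, hq₁, hq₂, ?_, ?_, ?_⟩
  · calc (q₁ : ℝ) ≤ Z ^ 8 := hq₁Z
      _ ≤ Y ^ 8 := by gcongr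
      _ ≤ Y ^ 100 := pow_le_pow_right₀ hY1 (by norm_num)
  · exact hq₂Y.trans (pow_le_pow_right₀ hY1 (by norm_num))
  · have hX0 : (0 : ℝ) < X := by
      have h1 := hdiv hX₁
      have h2 : 0 < (T₁ : ℝ) * D₁ * Y ^ 100 := by
        have : 0 < (T₁ : ℝ) := by linarith
        positivity
      linarith
    rw [avgC_re, avgR, Nat.card_Icc, Nat.add_sub_cancel, inv_eq_one_div,
      div_le_div_iff₀ hYpos (by push_cast; positivity)]
    push_cast
    rw [one_mul, mul_comm _ (Y ^ 100)]
    exact hle
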